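/- arXiv:2011.12578 — 2 statements merged into one kernel-verified Lean document; each statement's English description precedes it below -/
import Mathlib

section
/- The Aluffi transformation 𝒥 is an involution on the set of integer polynomials with no constant term: for every f ∈ ℤ[x] with f(0) = 0 one has 𝒥(𝒥(f)) = f. -/
open Polynomial

/-- The Aluffi transformation: `𝒥(f)` is the quotient of `x·f(−1−x)` by the monic
polynomial `x + 1`. -/
noncomputable def aluffiJ (f : Polynomial ℤ) : Polynomial ℤ :=
  (X * f.comp (-1 - X)) /ₘ (X + 1)

theorem aluffiJ_X_mul (g : Polynomial ℤ) :
    aluffiJ (X * g) = X * -(g.comp (-1 - X)) := by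
  have hm : (X + 1 : Polynomial ℤ).Monic := by simpa using monic_X_add_C (1 : ℤ)
  have h : X * (X * g).comp (-1 - X) = (X + 1) * (X * -(g.comp (-1 - X))) := by
    rw [mul_comp, X_comp]
    ring
  rw [aluffiJ, h, mul_divByMonic_cancel_left _ hm]

/-- The Aluffi transformation `𝒥` is an involution on integer polynomials with no
constant term: `𝒥(𝒥(f)) = f` whenever `f(0) = 0`. -/
theorem aluffiJ_involution (f : Polynomial ℤ) (hf : f.eval 0 = 0) :
    aluffiJ (aluffiJ f) = f := by
  obtain ⟨g, rfl⟩ : X ∣ f := by rwa [X_dvd_iff, coeff_zero_eq_eval_zero]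
  rw [aluffiJ_X_mul, aluffiJ_X_mul, neg_comp, neg_neg, comp_assoc]
  have h : (-1 - X : Polynomial ℤ).comp (-1 - X) = X := by simp
  rw [h, comp_X]
end

section
/- Let A be a commutative ring, let e ≥ 1, let c_0, c_1, …, c_e ∈ A with c_0 = 1, let d ∈ A, and let (s_m)_{m≥0} be a sequence in A with s_0 = 1 and s_m = 0 for all m > M (for some M). Set κ_k = Σ_{j=0}^{e−k} C(e−j, k)·c_j for 0 ≤ k ≤ e, where C(a,b) is the binomial coefficient. Then d · Σ_{m=0}^{M} ( Σ_{k=0}^{min(e, e−1+m)} κ_k · d^{e−1+m−k} ) · s_m = ( Σ_{k=0}^{e} d^{k}·(1+d)^{e−k}·c_k ) · ( Σ_{m=0}^{M} d^{m}·s_m ) − 1. -/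
/-- The homogenized sum of the coefficients `κ_k` of `c(E⊗𝓛)`, evaluated at `d`. -/
theorem sum_choose_mul_pow_eq {A : Type*} [CommRing A] (e : ℕ) (c : ℕ → A) (d : A) :
    ∑ k ∈ Finset.range (e + 1),
        (∑ j ∈ Finset.range (e - k + 1), (Nat.choose (e - j) k : A) * c j) * d ^ (e - k) =
      ∑ k ∈ Finset.range (e + 1), d ^ k * (1 + d) ^ (e - k) * c k := by
  simp_rw [Finset.sum_mul]
  rw [Finset.sum_comm' (t' := Finset.range (e + 1)) (s' := fun j => Finset.range (e - j + 1))
    (by intro k j; simp only [Finset.mem_range]; omega)]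
  refine Finset.sum_congr rfl fun j hj => ?_
  rw [add_pow, Finset.mul_sum, Finset.sum_mul]
  refine Finset.sum_congr rfl fun k hk => ?_
  simp only [Finset.mem_range] at hj hk
  rw [show e - k = j + (e - j - k) by omega, pow_add, one_pow]
  ring

/-- Ring-theoretic content of the key Lemma on pushforwards of `c(E⊗𝓛)/(1−d·c₁(𝓛))`:
with `κ_k = Σ_{j=0}^{e−k} C(e−j,k)·c_j`,
`d · Σ_{m=0}^{M} (Σ_{k=0}^{min(e, e−1+m)} κ_k·d^{e−1+m−k})·s_m
  = (Σ_{k=0}^{e} d^k·(1+d)^{e−k}·c_k)·(Σ_{m=0}^{M} d^m·s_m) − 1`. -/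
theorem pushforward_lemma {A : Type*} [CommRing A] (e M : ℕ) (he : 1 ≤ e)
    (c : ℕ → A) (hc0 : c 0 = 1) (d : A) (s : ℕ → A) (hs0 : s 0 = 1)
    (hs : ∀ m, M < m → s m = 0) :
    d * ∑ m ∈ Finset.range (M + 1),
        (∑ k ∈ Finset.range (min e (e - 1 + m) + 1),
            (∑ j ∈ Finset.range (e - k + 1), (Nat.choose (e - j) k : A) * c j) *
              d ^ (e - 1 + m - k)) * s m
      =
    (∑ k ∈ Finset.range (e + 1), d ^ k * (1 + d) ^ (e - k) * c k) *
        (∑ m ∈ Finset.range (M + 1), d ^ m * s m) - 1 := by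
  obtain ⟨n, rfl⟩ : ∃ n, e = n + 1 := ⟨e - 1, by omega⟩
  rw [← sum_choose_mul_pow_eq, Finset.sum_range_succ', Finset.sum_range_succ' _ M, mul_add,
    mul_add, Finset.mul_sum, Finset.mul_sum, add_sub_assoc]
  congr 1
  · refine Finset.sum_congr rfl fun m _ => ?_
    rw [min_eq_left (by omega), ← mul_assoc, ← mul_assoc, Finset.mul_sum, Finset.sum_mul,
      Finset.sum_mul, Finset.sum_mul]
    refine Finset.sum_congr rfl fun k hk => ?_
    have hk' := Finset.mem_range.1 hk
    rw [show n + 1 - 1 + (m + 1) - k = (n + 1 - k) + m by omega]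
    ring
  · rw [min_eq_right (by omega), Finset.sum_range_succ _ (n + 1)]
    simp only [hs0, mul_one, pow_zero, add_zero, Nat.add_sub_cancel, Nat.sub_self, zero_add,
      Finset.sum_range_one, Nat.sub_zero, Nat.choose_self, Nat.cast_one, hc0, add_sub_cancel_right]
    rw [Finset.mul_sum]
    refine Finset.sum_congr rfl fun k hk => ?_
    have hk' := Finset.mem_range.1 hk
    rw [show n + 1 - k = (n - k) + 1 by omega]
    ring
end
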